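/- Let d be real, h=d/2, and let Δ be complex with 2Δ+2−2h not a nonpositive integer. Then the boundary conformal block G_Δ^bdy is twice differentiable on (0,1) and satisfies the Casimir equation (D_bdy G_Δ^bdy)(ρ) = Δ(Δ−(d−1))·G_Δ^bdy(ρ) for all 0<ρ<1. -/

import Mathlib

open scoped Real
open Complex MeasureTheory Set ComplexConjugate

noncomputable section

/-- Pochhammer symbol `(a)ₙ = a (a+1) ⋯ (a+n−1)`. -/
def poch (a : ℂ) (n : ℕ) : ℂ := (ascPochhammer ℂ n).eval a

/-- Gauss hypergeometric series `₂F₁(a,b;c;z)`. -/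
def hyp2F1 (a b c z : ℂ) : ℂ :=
  ∑' n : ℕ, poch a n * poch b n / (poch c n * (n.factorial : ℂ)) * z ^ n

/-- Jacobi function `ϑ_α^{(p,q)}(x)` on `0 < x < 1`. -/
def thetaJ (p q α : ℂ) (x : ℝ) : ℂ :=
  (x : ℂ) ^ ((1 + p + q) / 2 + α) *
    hyp2F1 ((1 + p + q) / 2 + α) ((1 + p - q) / 2 + α) (1 + p) (1 - (x : ℂ))

/-- The boundary Casimir operator `D_bdy` (with `h = d/2`). -/
def Dbdy (h : ℝ) (f : ℝ → ℂ) (ρ : ℝ) : ℂ :=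
  (ρ : ℂ) ^ ((1 - h : ℝ) : ℂ) * (1 - (ρ : ℂ)) ^ ((2 * h : ℝ) : ℂ) *
    deriv (fun y : ℝ =>
      (y : ℂ) ^ ((h : ℝ) : ℂ) * (1 - (y : ℂ)) ^ ((2 - 2 * h : ℝ) : ℂ) * deriv f y) ρ

/-- The boundary conformal block `G_Δ^bdy`. -/
def Gbdy (h : ℝ) (Δ : ℂ) (ρ : ℝ) : ℂ :=
  (1 - (ρ : ℂ)) ^ Δ * hyp2F1 Δ (Δ + 1 - (h : ℂ)) (2 * Δ + 2 - 2 * (h : ℂ)) (1 - (ρ : ℂ))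

/-- Sequences with consecutive ratio tending to `1`; zeros are allowed. -/
def RatioTendstoOne (A : ℕ → ℂ) : Prop :=
  ∃ q : ℕ → ℂ, Filter.Tendsto q Filter.atTop (nhds 1) ∧ ∀ n, A (n + 1) = q n * A n

/-- Coefficients of the termwise derivative of the power series with coefficients `A`. -/
def derivCoeff (A : ℕ → ℂ) (n : ℕ) : ℂ := (n + 1) * A (n + 1)

theorem tendsto_natCast_add_div_add (a b : ℂ) :
    Filter.Tendsto (fun n : ℕ => ((n : ℂ) + a) / (n + b)) Filter.atTop (nhds 1) := by
  have h := tendsto_add_mul_div_add_mul_atTop_nhds a b (1 : ℂ) one_ne_zero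
  simpa [add_comm] using h

theorem RatioTendstoOne.map_derivCoeff {A : ℕ → ℂ} (hA : RatioTendstoOne A) :
    RatioTendstoOne (derivCoeff A) := by
  obtain ⟨q, hq, hqA⟩ := hA
  refine ⟨fun n => ((n : ℂ) + 2) / (n + 1) * q (n + 1), ?_, fun n => ?_⟩
  · simpa using (tendsto_natCast_add_div_add 2 1).mul (hq.comp (Filter.tendsto_add_atTop_nat 1))
  · have : (n : ℂ) + 1 ≠ 0 := Nat.cast_add_one_ne_zero n
    simp only [derivCoeff, hqA (n + 1)]
    push_cast
    field_simp
    ring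

theorem RatioTendstoOne.summable_norm {A : ℕ → ℂ} (hA : RatioTendstoOne A) {z : ℂ}
    (hz : ‖z‖ < 1) : Summable fun n => ‖A n * z ^ n‖ := by
  obtain ⟨q, hq, hqA⟩ := hA
  obtain ⟨r, hzr, hr⟩ := exists_between hz
  have hlim : Filter.Tendsto (fun n => ‖q n * z‖) Filter.atTop (nhds ‖z‖) := by
    simpa using (hq.mul_const z).norm
  refine summable_of_ratio_norm_eventually_le hr ?_
  filter_upwards [hlim.eventually (gt_mem_nhds hzr)] with n hn
  rw [norm_norm, norm_norm, hqA, pow_succ,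
    show q n * A n * (z ^ n * z) = (q n * z) * (A n * z ^ n) by ring, norm_mul]
  gcongr

theorem RatioTendstoOne.hasSum {A : ℕ → ℂ} (hA : RatioTendstoOne A) {z : ℂ}
    (hz : ‖z‖ < 1) : HasSum (fun n => A n * z ^ n) (∑' n, A n * z ^ n) :=
  (hA.summable_norm hz).of_norm.hasSum

theorem RatioTendstoOne.hasDerivAt {A : ℕ → ℂ} (hA : RatioTendstoOne A) {z : ℂ}
    (hz : ‖z‖ < 1) :
    HasDerivAt (fun w => ∑' n, A n * w ^ n) (∑' n, derivCoeff A n * z ^ n) z := by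
  obtain ⟨r, hzr, hr⟩ := exists_between hz
  have hr0 : 0 ≤ r := (norm_nonneg z).trans hzr.le
  have hrn : ‖(r : ℂ)‖ < 1 := by simpa [abs_of_nonneg hr0] using hr
  have hu : Summable fun n : ℕ => ‖A n * (n * (r : ℂ) ^ (n - 1))‖ := by
    rw [← summable_nat_add_iff 1]
    refine (hA.map_derivCoeff.summable_norm hrn).congr fun n => ?_
    simp only [derivCoeff, Nat.add_sub_cancel]
    push_cast
    congr 1
    ring
  have hmem : z ∈ Metric.ball (0 : ℂ) r := by simpa using hzr
  have key := hasDerivAt_tsum_of_isPreconnected (g := fun n w => A n * w ^ n)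
    (g' := fun n w => A n * (n * w ^ (n - 1))) hu Metric.isOpen_ball
    (convex_ball (0 : ℂ) r).isPreconnected
    (fun n w _ => (hasDerivAt_pow n w).const_mul (A n))
    (fun n w hw => by
      have hw' : ‖w‖ ≤ ‖(r : ℂ)‖ := by
        simpa [abs_of_nonneg hr0] using (mem_ball_zero_iff.mp hw).le
      simp only [norm_mul, norm_pow]
      gcongr)
    hmem (hA.hasSum hz).summable hmem
  have hs : Summable fun n : ℕ => A n * (n * z ^ (n - 1)) := by
    rw [← summable_nat_add_iff 1]
    refine (hA.map_derivCoeff.hasSum hz).summable.congr fun n => ?_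
    simp only [derivCoeff, Nat.add_sub_cancel]
    push_cast
    ring
  rw [hs.tsum_eq_zero_add] at key
  simp only [Nat.add_sub_cancel, Nat.cast_zero, zero_mul, mul_zero, zero_add] at key
  refine key.congr_deriv (tsum_congr fun n => ?_)
  simp only [derivCoeff]
  push_cast
  ring

theorem HasSum.mul_of_derivCoeff {A : ℕ → ℂ} {z s : ℂ}
    (hs : HasSum (fun n => derivCoeff A n * z ^ n) s) :
    HasSum (fun n : ℕ => n * A n * z ^ n) (z * s) := by
  rw [← hasSum_nat_add_iff' 1]
  simp only [Finset.sum_range_one, Nat.cast_zero, zero_mul, sub_zero]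
  refine (hs.mul_left z).congr_fun fun n => ?_
  simp only [derivCoeff]
  push_cast
  ring

/-- Coefficients of the Gauss hypergeometric series. -/
def hypCoeff (a b c : ℂ) (n : ℕ) : ℂ := poch a n * poch b n / (poch c n * (n.factorial : ℂ))

theorem poch_succ (a : ℂ) (n : ℕ) : poch a (n + 1) = poch a n * (a + n) :=
  ascPochhammer_succ_eval n a

theorem add_natCast_ne_zero {c : ℂ} (hc : ∀ n : ℕ, c ≠ -(n : ℂ)) (n : ℕ) : c + n ≠ 0 :=
  fun h => hc n (eq_neg_of_add_eq_zero_left h)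

theorem hypCoeff_succ (a b c : ℂ) (n : ℕ) :
    hypCoeff a b c (n + 1) =
      (a + n) * (b + n) / ((c + n) * (n + 1)) * hypCoeff a b c n := by
  simp only [hypCoeff, poch_succ, Nat.factorial_succ]
  push_cast
  rw [div_mul_div_comm]
  congr 1 <;> ring

theorem ratioTendstoOne_hypCoeff (a b c : ℂ) : RatioTendstoOne (hypCoeff a b c) := by
  refine ⟨_, ?_, hypCoeff_succ a b c⟩
  have h := (tendsto_natCast_add_div_add a c).mul (tendsto_natCast_add_div_add b 1)
  simp only [div_mul_div_comm, mul_one] at h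
  simpa only [add_comm] using h

theorem hyp2F1_ode (a b c : ℂ) (hc : ∀ n : ℕ, c ≠ -(n : ℂ)) {z : ℂ} (hz : ‖z‖ < 1) :
    z * (1 - z) * (∑' n, derivCoeff (derivCoeff (hypCoeff a b c)) n * z ^ n) +
      (c - (a + b + 1) * z) * (∑' n, derivCoeff (hypCoeff a b c) n * z ^ n) -
      a * b * hyp2F1 a b c z = 0 := by
  have hA := ratioTendstoOne_hypCoeff a b c
  have h0 : HasSum (fun n => hypCoeff a b c n * z ^ n) (hyp2F1 a b c z) := hA.hasSum hz
  have h1 := hA.map_derivCoeff.hasSum hz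
  have h2 := hA.map_derivCoeff.map_derivCoeff.hasSum hz
  set A := hypCoeff a b c with hAdef
  have hz1 := h1.mul_of_derivCoeff
  have hz2 := h2.mul_of_derivCoeff
  have hzz2 : HasSum (fun n : ℕ => n * (((n : ℂ) - 1) * A n) * z ^ n) (z * (z * _)) :=
    HasSum.mul_of_derivCoeff (A := fun n => ((n : ℂ) - 1) * A n) <| hz2.congr_fun fun n => by
      simp only [derivCoeff]
      push_cast
      ring
  have key := ((((hz2.sub hzz2).add (h1.mul_left c)).sub (hz1.mul_left (a + b + 1))).sub
    (h0.mul_left (a * b)))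
  refine Eq.trans ?_ (key.unique (hasSum_zero.congr_fun fun n => ?_))
  · ring
  · have hcn := add_natCast_ne_zero hc n
    have hn : (n : ℂ) + 1 ≠ 0 := Nat.cast_add_one_ne_zero n
    have hrec : (c + n) * (n + 1) * A (n + 1) = (a + n) * (b + n) * A n := by
      rw [hAdef, hypCoeff_succ]
      field_simp
    simp only [derivCoeff]
    linear_combination z ^ n * hrec

theorem hasDerivAt_one_sub_cpow (s : ℂ) {w : ℂ} (hw : 1 - w ∈ slitPlane) :
    HasDerivAt (fun x : ℂ => (1 - x) ^ s) (-(s * (1 - w) ^ (s - 1))) w := by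
  simpa using ((hasDerivAt_id w).const_sub 1).cpow_const (c := s) hw

theorem RatioTendstoOne.hasDerivAt_one_sub {A : ℕ → ℂ} (hA : RatioTendstoOne A) {w : ℂ}
    (hw : ‖1 - w‖ < 1) :
    HasDerivAt (fun x => ∑' n, A n * (1 - x) ^ n)
      (-∑' n, derivCoeff A n * (1 - w) ^ n) w := by
  simpa [Function.comp_def] using (hA.hasDerivAt hw).comp w ((hasDerivAt_id w).const_sub 1)

theorem stmt8 (d h : ℝ) (hh : h = d / 2) (Δ : ℂ)
    (hΔ : ∀ n : ℕ, 2 * Δ + 2 - 2 * (h : ℂ) ≠ -(n : ℂ)) :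
    ∀ ρ ∈ Ioo (0 : ℝ) 1,
      DifferentiableAt ℝ (Gbdy h Δ) ρ ∧
      DifferentiableAt ℝ (deriv (Gbdy h Δ)) ρ ∧
      Dbdy h (Gbdy h Δ) ρ = Δ * (Δ - ((d - 1 : ℝ) : ℂ)) * Gbdy h Δ ρ := by
  have hA := ratioTendstoOne_hypCoeff Δ (Δ + 1 - (h : ℂ)) (2 * Δ + 2 - 2 * (h : ℂ))
  have hode := fun z => hyp2F1_ode Δ (Δ + 1 - (h : ℂ)) (2 * Δ + 2 - 2 * (h : ℂ)) hΔ (z := z)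
  have hF : ∀ z, hyp2F1 Δ (Δ + 1 - (h : ℂ)) (2 * Δ + 2 - 2 * (h : ℂ)) z =
      ∑' n, hypCoeff Δ (Δ + 1 - (h : ℂ)) (2 * Δ + 2 - 2 * (h : ℂ)) n * z ^ n := fun _ => rfl
  set A := hypCoeff Δ (Δ + 1 - (h : ℂ)) (2 * Δ + 2 - 2 * (h : ℂ))
  have hslit : ∀ x ∈ Ioo (0 : ℝ) 1, 1 - (x : ℂ) ∈ slitPlane := fun x hx => by
    rw [← ofReal_one, ← ofReal_sub, ofReal_mem_slitPlane]
    exact sub_pos.mpr hx.2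
  have hnorm : ∀ x ∈ Ioo (0 : ℝ) 1, ‖1 - (x : ℂ)‖ < 1 := fun x hx => by
    rw [← ofReal_one, ← ofReal_sub, norm_real, Real.norm_eq_abs, abs_of_pos (sub_pos.mpr hx.2)]
    linarith [hx.1]
  set F₁ : ℂ → ℂ := fun w => -(Δ * (1 - w) ^ (Δ - 1)) * (∑' n, A n * (1 - w) ^ n) +
    (1 - w) ^ Δ * -∑' n, derivCoeff A n * (1 - w) ^ n with hF₁
  have hG : ∀ x ∈ Ioo (0 : ℝ) 1, HasDerivAt (Gbdy h Δ) (F₁ x) x := fun x hx =>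
    ((hasDerivAt_one_sub_cpow Δ (hslit x hx)).mul
      (hA.hasDerivAt_one_sub (hnorm x hx))).comp_ofReal
  intro ρ hρ
  have hnhds : Ioo (0 : ℝ) 1 ∈ nhds ρ := Ioo_mem_nhds hρ.1 hρ.2
  have hderiv : deriv (Gbdy h Δ) =ᶠ[nhds ρ] fun x => F₁ x := by
    filter_upwards [hnhds] with x hx using (hG x hx).deriv
  have hF₁' : HasDerivAt F₁
      (Δ * (Δ - 1) * (1 - (ρ : ℂ)) ^ (Δ - 1 - 1) * (∑' n, A n * (1 - (ρ : ℂ)) ^ n) +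
        2 * Δ * (1 - (ρ : ℂ)) ^ (Δ - 1) * (∑' n, derivCoeff A n * (1 - (ρ : ℂ)) ^ n) +
        (1 - (ρ : ℂ)) ^ Δ * ∑' n, derivCoeff (derivCoeff A) n * (1 - (ρ : ℂ)) ^ n) ρ := by
    refine ((((hasDerivAt_one_sub_cpow (Δ - 1) (hslit ρ hρ)).const_mul Δ).neg.mul
      (hA.hasDerivAt_one_sub (hnorm ρ hρ))).add
      ((hasDerivAt_one_sub_cpow Δ (hslit ρ hρ)).mul
        (hA.map_derivCoeff.hasDerivAt_one_sub (hnorm ρ hρ)).neg)).congr_deriv ?_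
    simp only [Pi.neg_apply]
    ring
  refine ⟨(hG ρ hρ).differentiableAt,
    (hF₁'.comp_ofReal.differentiableAt).congr_of_eventuallyEq hderiv, ?_⟩
  have hρ0 : (ρ : ℂ) ≠ 0 := ofReal_ne_zero.mpr hρ.1.ne'
  have hu0 : 1 - (ρ : ℂ) ≠ 0 := slitPlane_ne_zero (hslit ρ hρ)
  have hflux : HasDerivAt (fun y : ℝ =>
      (y : ℂ) ^ ((h : ℝ) : ℂ) * (1 - (y : ℂ)) ^ ((2 - 2 * h : ℝ) : ℂ) * F₁ y) _ ρ :=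
    ((((hasDerivAt_id (ρ : ℂ)).cpow_const (c := (h : ℂ)) (ofReal_mem_slitPlane.mpr hρ.1)).mul
      (hasDerivAt_one_sub_cpow ((2 - 2 * h : ℝ) : ℂ) (hslit ρ hρ))).mul hF₁').comp_ofReal
  have heq : (fun y : ℝ => (y : ℂ) ^ ((h : ℝ) : ℂ) * (1 - (y : ℂ)) ^ ((2 - 2 * h : ℝ) : ℂ) *
      deriv (Gbdy h Δ) y) =ᶠ[nhds ρ] fun y : ℝ =>
      (y : ℂ) ^ ((h : ℝ) : ℂ) * (1 - (y : ℂ)) ^ ((2 - 2 * h : ℝ) : ℂ) * F₁ y := by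
    filter_upwards [hderiv] with y hy
    rw [hy]
  have hd : (d : ℂ) = 2 * h := by rw [hh]; push_cast; ring
  have hode' := hode _ (hnorm ρ hρ)
  rw [Dbdy, heq.deriv_eq, hflux.deriv]
  simp only [Gbdy, hF, hF₁, Pi.mul_apply, id] at hode' ⊢
  generalize (∑' n, A n * (1 - (ρ : ℂ)) ^ n) = S₀ at *
  generalize (∑' n, derivCoeff A n * (1 - (ρ : ℂ)) ^ n) = S₁ at *
  generalize (∑' n, derivCoeff (derivCoeff A) n * (1 - (ρ : ℂ)) ^ n) = S₂ at *
  push_cast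
  have hP : (ρ : ℂ) ^ (h : ℂ) ≠ 0 := by simp [cpow_eq_zero_iff, hρ0]
  have hQ : (1 - (ρ : ℂ)) ^ (2 * (h : ℂ)) ≠ 0 := by simp [cpow_eq_zero_iff, hu0]
  have hu2 : (1 - (ρ : ℂ)) ^ (2 : ℂ) = (1 - (ρ : ℂ)) ^ 2 := cpow_ofNat _ 2
  simp only [cpow_sub _ _ hρ0, cpow_sub _ _ hu0, cpow_one, hu2, hd]
  generalize (ρ : ℂ) ^ (h : ℂ) = P at *
  generalize (1 - (ρ : ℂ)) ^ (2 * (h : ℂ)) = Q at *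
  generalize (1 - (ρ : ℂ)) ^ Δ = R at *
  field_simp
  linear_combination R * (1 - (ρ : ℂ)) * hode'
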